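/- Pythagorean eigenvalue error theorem: let V be a real inner product space with inner product (·,·), and let a : V × V → ℝ be a symmetric bilinear form. Suppose u, uʰ ∈ V satisfy (u,u) = 1 and (uʰ,uʰ) = 1, and λ ∈ ℝ satisfies a(u,v) = λ(u,v) for every v ∈ V. Set λʰ := a(uʰ,uʰ). Then λʰ − λ + λ·(uʰ−u, uʰ−u) = a(uʰ−u, uʰ−u); that is, the eigenvalue error plus λ times the squared L²-norm error of the eigenfunction equals the squared energy-norm error of the eigenfunction. -/

import Mathlib

open RealInnerProductSpace

/-- Pythagorean eigenvalue error theorem: in a real inner product space `V`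
with a symmetric bilinear form `a`, if `u`, `uʰ` are `L²`-normalized,
`a(u,·) = λ(u,·)`, and `λʰ = a(uʰ,uʰ)`, then
`λʰ − λ + λ·‖uʰ−u‖² = a(uʰ−u, uʰ−u)`. -/
theorem pythagorean_eigenvalue_error {V : Type*}
    [NormedAddCommGroup V] [InnerProductSpace ℝ V]
    (a : V →ₗ[ℝ] V →ₗ[ℝ] ℝ) (hsymm : ∀ x y : V, a x y = a y x)
    (u uh : V) (hu : ⟪u, u⟫ = (1 : ℝ)) (huh : ⟪uh, uh⟫ = (1 : ℝ))
    (lam : ℝ) (heig : ∀ v : V, a u v = lam * ⟪u, v⟫) :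
    a uh uh - lam + lam * ⟪uh - u, uh - u⟫ = a (uh - u) (uh - u) := by
  rw [inner_sub_left, inner_sub_right, inner_sub_right, real_inner_comm u uh, hu, huh]
  simp only [map_sub, LinearMap.sub_apply]
  rw [hsymm uh u, heig u, heig uh, hu]
  ring
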